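/- arXiv:1405.3126 — 2 statements merged into one kernel-verified Lean document; each statement's English description precedes it below -/
import Mathlib

section
/- Let q = 2 and let the design space consist of the three binary design points x_1 = (1, 0)ᵀ, x_2 = (0, 1)ᵀ, x_3 = (1, 1)ᵀ in ℝ². Fix t ∈ [0,1) and let ξ_t be the unique root in [1/2, 1) of u_t(ξ) = 1 − 2tξ − (3 − 2t)ξ² + 4tξ³ − 2t²ξ⁴. Then the design measure p_A assigning mass 1 − ξ_t to each of x_1 and x_2 and mass 2ξ_t − 1 to x_3 is A-optimal: H(p_A) is invertible and tr{H(p_A)}⁻¹ ≤ tr{H(p)}⁻¹ for every design measure p on {x_1, x_2, x_3} with H(p) invertible. -/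
open Matrix BigOperators Finset

noncomputable section

/-- A design measure: nonnegative masses summing to 1. -/
def designMeasure {n : ℕ} (p : Fin n → ℝ) : Prop :=
  (∀ i, 0 ≤ p i) ∧ ∑ i, p i = 1

/-- G(p) = Σ pᵢ xᵢ xᵢᵀ. -/
def Gmat {q n : ℕ} (x : Fin n → Fin q → ℝ) (p : Fin n → ℝ) : Matrix (Fin q) (Fin q) ℝ :=
  ∑ i, p i • Matrix.vecMulVec (x i) (x i)

/-- g(p) = Σ pᵢ xᵢ. -/
def gvec {q n : ℕ} (x : Fin n → Fin q → ℝ) (p : Fin n → ℝ) : Fin q → ℝ :=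
  ∑ i, p i • x i

/-- H(p) = G(p) − t g(p) g(p)ᵀ. -/
def Hmat {q n : ℕ} (t : ℝ) (x : Fin n → Fin q → ℝ) (p : Fin n → ℝ) : Matrix (Fin q) (Fin q) ℝ :=
  Gmat x p - t • Matrix.vecMulVec (gvec x p) (gvec x p)

/-- ψ_{Di}(p). -/
def psiD {q n : ℕ} (t : ℝ) (x : Fin n → Fin q → ℝ) (p : Fin n → ℝ) (i : Fin n) : ℝ :=
  (1 - t) * (x i ⬝ᵥ ((Hmat t x p)⁻¹ *ᵥ x i))
    + t * ((x i - gvec x p) ⬝ᵥ ((Hmat t x p)⁻¹ *ᵥ (x i - gvec x p)))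

/-- ψ_{Ai}(p). -/
def psiA {q n : ℕ} (t : ℝ) (x : Fin n → Fin q → ℝ) (p : Fin n → ℝ) (i : Fin n) : ℝ :=
  (1 - t) * (x i ⬝ᵥ (((Hmat t x p)⁻¹ * (Hmat t x p)⁻¹) *ᵥ x i))
    + t * ((x i - gvec x p) ⬝ᵥ (((Hmat t x p)⁻¹ * (Hmat t x p)⁻¹) *ᵥ (x i - gvec x p)))

end
lemma trace_inv_two (a b c : ℝ) :
    Matrix.trace ((!![a, c; c, b] : Matrix (Fin 2) (Fin 2) ℝ)⁻¹) = (a + b) / (a * b - c * c) := by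
  rw [Matrix.inv_def, Matrix.adjugate_fin_two_of, Matrix.det_fin_two_of, Matrix.trace_smul,
    Matrix.trace_fin_two_of, Ring.inverse_eq_inv', smul_eq_mul]
  ring

lemma Hmat_three (t : ℝ) (p : Fin 3 → ℝ) :
    Hmat t (![![1, 0], ![0, 1], ![1, 1]] : Fin 3 → Fin 2 → ℝ) p =
      !![(p 0 + p 2) - t * (p 0 + p 2) ^ 2, p 2 - t * (p 0 + p 2) * (p 1 + p 2);
        p 2 - t * (p 0 + p 2) * (p 1 + p 2), (p 1 + p 2) - t * (p 1 + p 2) ^ 2] := by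
  ext i j
  fin_cases i <;> fin_cases j <;>
    simp [Hmat, Gmat, gvec, Fin.sum_univ_three, -mul_eq_mul_left_iff] <;> ring_nf <;> simp

lemma inv_tangent (s s0 : ℝ) (hs : 0 < s) (hs0 : 0 < s0) :
    1 / s0 - (s - s0) / s0 ^ 2 ≤ 1 / s := by
  have h : 1 / s - (1 / s0 - (s - s0) / s0 ^ 2) = (s - s0) ^ 2 / (s * s0 ^ 2) := by
    field_simp
    ring
  have h2 : 0 ≤ (s - s0) ^ 2 / (s * s0 ^ 2) := by positivity
  linarith

lemma s_pos (t m : ℝ) (ht0 : 0 ≤ t) (ht1 : t < 1) (h1 : 1 / 2 ≤ m) (h2 : m ≤ 1) :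
    0 < 3 * m - 1 - 2 * t * m ^ 2 := by
  have : 0 ≤ (2 * m - 1) * (1 - m) := mul_nonneg (by linarith) (by linarith)
  have hm : 0 < m ^ 2 := by positivity
  have : 0 < (1 - t) * m ^ 2 := mul_pos (by linarith) hm
  nlinarith

lemma oneD (t ξ m : ℝ) (ht0 : 0 ≤ t) (ht1 : t < 1) (h1 : 1 / 2 ≤ ξ) (h2 : ξ < 1)
    (hξroot : 1 - 2*t*ξ - (3 - 2*t)*ξ^2 + 4*t*ξ^3 - 2*t^2*ξ^4 = 0)
    (hm1 : 1 / 2 ≤ m) (hm2 : m < 1) :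
    1 / (3 * ξ - 1 - 2 * t * ξ ^ 2) + 1 / (1 - ξ) ≤
      1 / (3 * m - 1 - 2 * t * m ^ 2) + 1 / (1 - m) := by
  have hs0 := s_pos t ξ ht0 ht1 h1 h2.le
  have hs := s_pos t m ht0 ht1 hm1 hm2.le
  have A := inv_tangent _ _ hs hs0
  have B := inv_tangent (1 - m) (1 - ξ) (by linarith) (by linarith)
  have hd : 0 < 1 - ξ := by linarith
  have key : (3 * ξ - 1 - 2 * t * ξ ^ 2) ^ 2 = (3 - 4 * t * ξ) * (1 - ξ) ^ 2 := by
    linear_combination (-2) * hξroot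
  have C : (3 * m - 1 - 2 * t * m ^ 2 - (3 * ξ - 1 - 2 * t * ξ ^ 2)) /
      (3 * ξ - 1 - 2 * t * ξ ^ 2) ^ 2 ≤ (m - ξ) / (1 - ξ) ^ 2 := by
    rw [div_le_div_iff₀ (by positivity) (by positivity), key]
    have h3 : 0 ≤ t * (m - ξ) ^ 2 * (1 - ξ) ^ 2 := by positivity
    nlinarith
  have D : (1 - m - (1 - ξ)) / (1 - ξ) ^ 2 = - ((m - ξ) / (1 - ξ) ^ 2) := by
    rw [← neg_div]; congr 1; ring
  linarith

theorem statement_11 (t : ℝ) (ht0 : 0 ≤ t) (ht1 : t < 1) (ξ : ℝ)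
    (hξmem : ξ ∈ Set.Ico (1/2 : ℝ) 1)
    (hξroot : 1 - 2*t*ξ - (3 - 2*t)*ξ^2 + 4*t*ξ^3 - 2*t^2*ξ^4 = 0) :
    IsUnit (Hmat t (![![1, 0], ![0, 1], ![1, 1]] : Fin 3 → Fin 2 → ℝ)
        ![1 - ξ, 1 - ξ, 2*ξ - 1]).det
    ∧ ∀ p : Fin 3 → ℝ, designMeasure p →
        IsUnit (Hmat t (![![1, 0], ![0, 1], ![1, 1]] : Fin 3 → Fin 2 → ℝ) p).det →
        Matrix.trace ((Hmat t (![![1, 0], ![0, 1], ![1, 1]] : Fin 3 → Fin 2 → ℝ)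
            ![1 - ξ, 1 - ξ, 2*ξ - 1])⁻¹)
          ≤ Matrix.trace ((Hmat t (![![1, 0], ![0, 1], ![1, 1]] : Fin 3 → Fin 2 → ℝ) p)⁻¹) := by
  obtain ⟨h1, h2⟩ := hξmem
  have hs0 := s_pos t ξ ht0 ht1 h1 h2.le
  have hd0 : 0 < 1 - ξ := by linarith
  have hA : Hmat t (![![1, 0], ![0, 1], ![1, 1]] : Fin 3 → Fin 2 → ℝ)
        ![1 - ξ, 1 - ξ, 2*ξ - 1] = !![ξ - t * ξ ^ 2, 2 * ξ - 1 - t * ξ ^ 2;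
          2 * ξ - 1 - t * ξ ^ 2, ξ - t * ξ ^ 2] := by
    rw [Hmat_three]
    ext i j
    fin_cases i <;> fin_cases j <;> simp <;> ring
  rw [hA]
  constructor
  · rw [Matrix.det_fin_two_of, isUnit_iff_ne_zero]
    have := mul_pos hs0 hd0
    nlinarith
  · intro p hp hu
    obtain ⟨hp, hsum⟩ := hp
    rw [Fin.sum_univ_three] at hsum
    rw [Hmat_three] at hu ⊢
    rw [Matrix.det_fin_two_of, isUnit_iff_ne_zero] at hu
    rw [trace_inv_two, trace_inv_two]
    have p0 := hp 0
    have p1 := hp 1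
    have p2 := hp 2
    generalize p 0 = x at *
    generalize p 1 = y at *
    generalize p 2 = z at *
    obtain rfl : z = 1 - x - y := by linarith
    set m := 1 - (x + y) / 2 with hm
    have hs := s_pos t m ht0 ht1 (by linarith) (by linarith)
    set s := 3 * m - 1 - 2 * t * m ^ 2 with hsdef
    set d := 1 - m - t * (x - y) ^ 2 / 2 with hd
    set e := (x - y) * (1 - 2 * t * m) / 2 with he
    have hdet : (x + (1 - x - y) - t * (x + (1 - x - y)) ^ 2) *
        (y + (1 - x - y) - t * (y + (1 - x - y)) ^ 2) -
        (1 - x - y - t * (x + (1 - x - y)) * (y + (1 - x - y))) *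
        (1 - x - y - t * (x + (1 - x - y)) * (y + (1 - x - y))) = s * d - e ^ 2 := by
      simp only [hsdef, hd, he, hm]; ring
    have hdet2 : s * d - e ^ 2 = (1 - t) * (x * y + x * (1 - x - y) + y * (1 - x - y))
        + t * (x * y * (1 - x - y)) := by
      simp only [hsdef, hd, he, hm]; ring
    have htr : (x + (1 - x - y) - t * (x + (1 - x - y)) ^ 2) +
        (y + (1 - x - y) - t * (y + (1 - x - y)) ^ 2) = s + d := by
      simp only [hsdef, hd, hm]; ring
    rw [hdet] at hu
    rw [hdet, htr]
    have ht : 0 ≤ 1 - t := by linarith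
    have hge : 0 ≤ s * d - e ^ 2 := by rw [hdet2]; positivity
    have hpos : 0 < s * d - e ^ 2 := lt_of_le_of_ne hge (Ne.symm hu)
    have hdpos : 0 < d := by
      have : 0 < s * d := by nlinarith [sq_nonneg e]
      exact (pos_iff_pos_of_mul_pos this).mp hs
    have hdle : d ≤ 1 - m := by
      have : 0 ≤ t * (x - y) ^ 2 := by positivity
      rw [hd]; linarith
    have hmain := oneD t ξ m ht0 ht1 h1 h2 hξroot (by linarith) (by linarith)
    have e1 : (ξ - t * ξ ^ 2 + (ξ - t * ξ ^ 2)) / ((ξ - t * ξ ^ 2) * (ξ - t * ξ ^ 2) -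
        (2 * ξ - 1 - t * ξ ^ 2) * (2 * ξ - 1 - t * ξ ^ 2)) =
        1 / (3 * ξ - 1 - 2 * t * ξ ^ 2) + 1 / (1 - ξ) := by
      rw [div_add_div _ _ hs0.ne' hd0.ne']
      congr 1 <;> ring
    have e2 : 1 / (1 - m) ≤ 1 / d := one_div_le_one_div_of_le hdpos hdle
    have e3 : 1 / s + 1 / d = (s + d) / (s * d) := by
      field_simp
      ring
    have e4 : (s + d) / (s * d) ≤ (s + d) / (s * d - e ^ 2) := by
      apply div_le_div_of_nonneg_left (by linarith) hpos
      linarith [sq_nonneg e]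
    rw [e1]
    linarith
end

section
/- Let q = 2m with m ≥ 2 an integer, and let the design space Ω be the set of all nonzero vectors in {0,1}^q. Let p_ev1 be the design measure assigning mass (n_m + n_{m+1})⁻¹, where n_j = C(q,j), to each design point with exactly m or m+1 ones and mass 0 to every other design point. Then for t ∈ [0,1), p_ev1 is D-optimal (det H(p_ev1) ≥ det H(p) for every design measure p on Ω with H(p) invertible, and H(p_ev1) is invertible) if and only if 0 ≤ t ≤ (q+1)/(q+2). -/
open Matrix BigOperators Finset

noncomputable section

/-- The binary design point (0/1 vector) with support `S`. -/
def ind {q : ℕ} (S : Finset (Fin q)) : Fin q → ℝ := fun i => if i ∈ S then 1 else 0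

/-- A design measure on the nonzero binary vectors of length `q`, indexed by
their supports: nonnegative masses summing to 1, with zero mass on the zero vector. -/
def designMeasureB {q : ℕ} (p : Finset (Fin q) → ℝ) : Prop :=
  p ∅ = 0 ∧ (∀ S, 0 ≤ p S) ∧ ∑ S : Finset (Fin q), p S = 1

/-- G(p) = Σ p_x x xᵀ. -/
def GmatB {q : ℕ} (p : Finset (Fin q) → ℝ) : Matrix (Fin q) (Fin q) ℝ :=
  ∑ S : Finset (Fin q), p S • Matrix.vecMulVec (ind S) (ind S)

/-- g(p) = Σ p_x x. -/
def gvecB {q : ℕ} (p : Finset (Fin q) → ℝ) : Fin q → ℝ :=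
  ∑ S : Finset (Fin q), p S • ind S

/-- H(p) = G(p) − t g(p) g(p)ᵀ. -/
def HmatB {q : ℕ} (t : ℝ) (p : Finset (Fin q) → ℝ) : Matrix (Fin q) (Fin q) ℝ :=
  GmatB p - t • Matrix.vecMulVec (gvecB p) (gvecB p)

/-- The all-ones q×q matrix J_q. -/
def Jmat (q : ℕ) : Matrix (Fin q) (Fin q) ℝ := Matrix.of fun _ _ => 1

end
lemma aux_G_apply {q : ℕ} (p : Finset (Fin q) → ℝ) (i j : Fin q) :
    GmatB p i j = ∑ S : Finset (Fin q), p S * (ind S i * ind S j) := by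
  simp [GmatB, Matrix.sum_apply, Matrix.vecMulVec_apply]

lemma aux_g_apply {q : ℕ} (p : Finset (Fin q) → ℝ) (i : Fin q) :
    gvecB p i = ∑ S : Finset (Fin q), p S * ind S i := by
  simp [gvecB, Finset.sum_apply]

lemma aux_H_apply {q : ℕ} (t : ℝ) (p : Finset (Fin q) → ℝ) (i j : Fin q) :
    HmatB t p i j = GmatB p i j - t * (gvecB p i * gvecB p j) := by
  simp [HmatB, Matrix.vecMulVec_apply]

lemma aux_ind_sum {q : ℕ} (S : Finset (Fin q)) : ∑ i, ind S i = (S.card : ℝ) := by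
  simp [ind]

lemma aux_ind_sq {q : ℕ} (S : Finset (Fin q)) (i : Fin q) : ind S i * ind S i = ind S i := by
  simp [ind]

/-- first moment of the cardinality -/
lemma aux_sum_g {q : ℕ} (p : Finset (Fin q) → ℝ) :
    ∑ i, gvecB p i = ∑ S : Finset (Fin q), p S * (S.card : ℝ) := by
  simp_rw [aux_g_apply]
  rw [Finset.sum_comm]
  simp_rw [← Finset.mul_sum, aux_ind_sum]

lemma aux_trace_G {q : ℕ} (p : Finset (Fin q) → ℝ) :
    ∑ i, GmatB p i i = ∑ S : Finset (Fin q), p S * (S.card : ℝ) := by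
  simp_rw [aux_G_apply, aux_ind_sq]
  rw [Finset.sum_comm]
  simp_rw [← Finset.mul_sum, aux_ind_sum]

lemma aux_sum_G {q : ℕ} (p : Finset (Fin q) → ℝ) :
    ∑ i, ∑ j, GmatB p i j = ∑ S : Finset (Fin q), p S * (S.card : ℝ) ^ 2 := by
  simp_rw [aux_G_apply]
  have h : ∀ i : Fin q, ∑ j, ∑ S : Finset (Fin q), p S * (ind S i * ind S j)
      = ∑ S : Finset (Fin q), p S * (ind S i * S.card) := by
    intro i
    rw [Finset.sum_comm]
    simp_rw [← Finset.mul_sum, aux_ind_sum]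
  simp_rw [h]
  rw [Finset.sum_comm]
  simp_rw [← Finset.mul_sum, ← Finset.sum_mul, aux_ind_sum, sq]

/-- symmetric matrices of the form c I + d J -/
def cdMat (q : ℕ) (c d : ℝ) : Matrix (Fin q) (Fin q) ℝ :=
  Matrix.of fun i j => (if i = j then c else 0) + d

lemma aux_det_cd {q : ℕ} (hq : 1 ≤ q) (c d : ℝ) (hc : c ≠ 0) :
    (cdMat q c d).det = c ^ (q - 1) * (c + q * d) := by
  have h : cdMat q c d = c • ((1 : Matrix (Fin q) (Fin q) ℝ) +
      Matrix.replicateCol Unit (fun _ : Fin q => d / c) *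
      Matrix.replicateRow Unit (fun _ : Fin q => (1 : ℝ))) := by
    ext i j
    simp [cdMat, Matrix.mul_apply, Matrix.one_apply, mul_add]
    field_simp
  rw [h, Matrix.det_smul, Matrix.det_one_add_replicateCol_mul_replicateRow]
  obtain ⟨n, rfl⟩ : ∃ n, q = n + 1 := ⟨q - 1, by omega⟩
  simp [dotProduct, pow_succ]
  field_simp

lemma aux_psd_det_le {q : ℕ} (A : Matrix (Fin q) (Fin q) ℝ) (hA : A.PosSemidef)
    (htr : A.trace ≤ q) : A.det ≤ 1 := by
  have h1 := hA.isHermitian.det_eq_prod_eigenvalues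
  have h2 := hA.isHermitian.trace_eq_sum_eigenvalues
  simp only [RCLike.ofReal_real_eq_id, id] at h1 h2
  rw [h1]
  calc ∏ i, hA.isHermitian.eigenvalues i
      ≤ ∏ i, Real.exp (hA.isHermitian.eigenvalues i - 1) := by
        apply Finset.prod_le_prod
        · intro i _; exact hA.eigenvalues_nonneg i
        · intro i _
          have := Real.add_one_le_exp (hA.isHermitian.eigenvalues i - 1)
          linarith
    _ = Real.exp (A.trace - q) := by
        rw [← Real.exp_sum, Finset.sum_sub_distrib, h2]; simp
    _ ≤ 1 := by
        rw [Real.exp_le_one_iff]; linarith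

open scoped MatrixOrder in
lemma aux_det_mul_le {q : ℕ} (M H : Matrix (Fin q) (Fin q) ℝ) (hM : M.PosSemidef)
    (hH : H.PosSemidef) (htr : (M * H).trace ≤ q) : M.det * H.det ≤ 1 := by
  obtain ⟨B, rfl⟩ := CStarAlgebra.nonneg_iff_eq_star_mul_self.mp hH.nonneg
  rw [Matrix.star_eq_conjTranspose] at *
  have h := aux_psd_det_le (B * M * Bᴴ) (hM.mul_mul_conjTranspose_same B) (by
    rw [Matrix.mul_assoc, Matrix.trace_mul_comm, Matrix.mul_assoc]; exact htr)
  calc M.det * (Bᴴ * B).det = (B * M * Bᴴ).det := by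
        simp only [Matrix.det_mul]; ring
    _ ≤ 1 := h

lemma aux_H_psd {q : ℕ} (t : ℝ) (ht : t ≤ 1) (p : Finset (Fin q) → ℝ) (hp : designMeasureB p) :
    (HmatB t p).PosSemidef := by
  obtain ⟨-, h0, h1⟩ := hp
  have h : HmatB t p = ∑ S : Finset (Fin q), p S • Matrix.vecMulVec (ind S - gvecB p)
      (star (ind S - gvecB p)) + (1 - t) • Matrix.vecMulVec (gvecB p) (star (gvecB p)) := by
    ext i j
    rw [aux_H_apply]
    simp only [Matrix.add_apply, Matrix.sum_apply, Matrix.smul_apply, Matrix.vecMulVec_apply,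
      Pi.sub_apply, star_trivial, smul_eq_mul]
    have e : ∀ S : Finset (Fin q), p S * ((ind S i - gvecB p i) * (ind S j - gvecB p j)) =
        p S * (ind S i * ind S j) - gvecB p j * (p S * ind S i) - gvecB p i * (p S * ind S j)
          + gvecB p i * gvecB p j * p S := fun S => by ring
    simp_rw [e]
    rw [Finset.sum_add_distrib, Finset.sum_sub_distrib, Finset.sum_sub_distrib,
      ← Finset.mul_sum, ← Finset.mul_sum, ← Finset.mul_sum, h1, ← aux_G_apply, ← aux_g_apply,
      ← aux_g_apply]
    ring
  rw [h]
  refine Matrix.PosSemidef.add (Matrix.posSemidef_sum _ fun S _ => ?_) ?_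
  · exact (Matrix.posSemidef_vecMulVec_self_star _).smul (h0 S)
  · exact (Matrix.posSemidef_vecMulVec_self_star _).smul (by linarith)

lemma aux_cd_psd {q : ℕ} (c d : ℝ) (hc : 0 ≤ c) (hd : 0 ≤ d) : (cdMat q c d).PosSemidef := by
  have h : cdMat q c d = c • 1 + d • Matrix.vecMulVec (fun _ => 1) (star (fun _ => 1)) := by
    ext i j
    simp [cdMat, Matrix.vecMulVec_apply, Matrix.one_apply]
  rw [h]
  exact (Matrix.PosSemidef.one.smul hc).add ((Matrix.posSemidef_vecMulVec_self_star _).smul hd)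

lemma aux_cd_mul {q : ℕ} (c d c' d' : ℝ) :
    cdMat q c d * cdMat q c' d' = cdMat q (c * c') (c * d' + d * c' + q * d * d') := by
  ext i j
  simp [cdMat, Matrix.mul_apply, add_mul, mul_add, Finset.sum_add_distrib]
  split_ifs <;> ring

lemma aux_cd_one {q : ℕ} : cdMat q 1 0 = 1 := by
  ext i j
  simp [cdMat, Matrix.one_apply]

lemma aux_trace_cd_mul {q : ℕ} (c d : ℝ) (H : Matrix (Fin q) (Fin q) ℝ) :
    (cdMat q c d * H).trace = c * ∑ i, H i i + d * ∑ i, ∑ j, H i j := by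
  simp [cdMat, Matrix.trace, Matrix.mul_apply, add_mul, Finset.sum_add_distrib, Finset.mul_sum]
  rw [Finset.sum_comm]

lemma aux_ind_map {q : ℕ} (e : Equiv.Perm (Fin q)) (S : Finset (Fin q)) (i : Fin q) :
    ind (S.map e.toEmbedding) (e i) = ind S i := by
  simp [ind]

lemma aux_perm_G {q : ℕ} (f : ℕ → ℝ) (e : Equiv.Perm (Fin q)) (i j : Fin q) :
    GmatB (fun S => f S.card) (e i) (e j) = GmatB (fun S => f S.card) i j := by
  rw [aux_G_apply, aux_G_apply]
  refine (Fintype.sum_equiv (Equiv.finsetCongr e) _ _ fun S => ?_).symm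
  simp [aux_ind_map]

lemma aux_perm_g {q : ℕ} (f : ℕ → ℝ) (e : Equiv.Perm (Fin q)) (i : Fin q) :
    gvecB (fun S => f S.card) (e i) = gvecB (fun S => f S.card) i := by
  rw [aux_g_apply, aux_g_apply]
  refine (Fintype.sum_equiv (Equiv.finsetCongr e) _ _ fun S => ?_).symm
  simp [aux_ind_map]

lemma aux_exch {q : ℕ} (hq : 2 ≤ q) (t : ℝ) (f : ℕ → ℝ) (u v : ℝ)
    (hu : ∑ S : Finset (Fin q), f S.card * (S.card : ℝ) = u)
    (hv : ∑ S : Finset (Fin q), f S.card * (S.card : ℝ) ^ 2 = v) :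
    HmatB t (fun S : Finset (Fin q) => f S.card) =
      cdMat q ((q * u - v) / (q * (q - 1))) ((v - u) / (q * (q - 1)) - t * (u / q) ^ 2) := by
  have hq0 : (q : ℝ) ≠ 0 := by positivity
  have hq1 : (q : ℝ) - 1 ≠ 0 := by
    have : (2 : ℝ) ≤ q := by exact_mod_cast hq
    linarith
  let z : Fin q := ⟨0, by omega⟩
  let o : Fin q := ⟨1, by omega⟩
  have hzo : z ≠ o := by simp [z, o]
  set p : Finset (Fin q) → ℝ := fun S => f S.card with hp
  have hg : ∀ i, gvecB p i = gvecB p z := by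
    intro i
    have := aux_perm_g f (Equiv.swap z i) z
    rwa [Equiv.swap_apply_left] at this
  have hGd : ∀ i, GmatB p i i = GmatB p z z := by
    intro i
    have := aux_perm_G f (Equiv.swap z i) z z
    rwa [Equiv.swap_apply_left] at this
  have hGo : ∀ i j, i ≠ j → GmatB p i j = GmatB p z o := by
    intro i j hij
    obtain ⟨e, he1, he2⟩ : ∃ e : Equiv.Perm (Fin q), e z = i ∧ e o = j := by
      refine ⟨(Equiv.swap z i).trans (Equiv.swap ((Equiv.swap z i) o) j), ?_, ?_⟩
      · simp only [Equiv.trans_apply, Equiv.swap_apply_left]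
        apply Equiv.swap_apply_of_ne_of_ne _ hij
        intro h
        have h2 : (Equiv.swap z i) z = (Equiv.swap z i) o := by
          rw [Equiv.swap_apply_left]; exact h
        exact hzo ((Equiv.swap z i).injective h2)
      · simp
    have := aux_perm_G f e z o
    rwa [he1, he2] at this
  have e1 : (q : ℝ) * gvecB p z = u := by
    rw [← hu, ← aux_sum_g p]
    rw [Finset.sum_congr rfl fun i _ => hg i]
    simp
  have e2 : (q : ℝ) * GmatB p z z = u := by
    rw [← hu, ← aux_trace_G p]
    rw [Finset.sum_congr rfl fun i _ => hGd i]
    simp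
  have e3 : (q : ℝ) * (GmatB p z z + (q - 1) * GmatB p z o) = v := by
    rw [← hv, ← aux_sum_G p]
    have : ∀ i j, GmatB p i j = (if i = j then GmatB p z z - GmatB p z o else 0) + GmatB p z o := by
      intro i j
      by_cases h : i = j
      · subst h; simp [hGd]
      · simp [h, hGo i j h]
    rw [Finset.sum_congr rfl fun i _ => Finset.sum_congr rfl fun j _ => this i j]
    simp [Finset.sum_add_distrib]
    ring
  have a1 : gvecB p z = u / q := by field_simp; linarith
  have a2 : GmatB p z z = u / q := by field_simp; linarith
  have a3 : GmatB p z o = (v - u) / (q * (q - 1)) := by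
    field_simp
    linarith
  ext i j
  rw [aux_H_apply, hg i, hg j]
  by_cases h : i = j
  · subst h
    rw [hGd, a1, a2]
    simp [cdMat]
    field_simp
    ring
  · rw [hGo i j h, a1, a3]
    simp only [cdMat, h, Matrix.of_apply, if_false]
    ring

lemma aux_det_exch {q : ℕ} (hq : 2 ≤ q) (t : ℝ) (f : ℕ → ℝ) (u v : ℝ)
    (hu : ∑ S : Finset (Fin q), f S.card * (S.card : ℝ) = u)
    (hv : ∑ S : Finset (Fin q), f S.card * (S.card : ℝ) ^ 2 = v) (hne : (q : ℝ) * u - v ≠ 0) :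
    (HmatB t (fun S : Finset (Fin q) => f S.card)).det =
      ((q * u - v) / (q * (q - 1))) ^ (q - 1) * ((v - t * u ^ 2) / q) := by
  have hq0 : (q : ℝ) ≠ 0 := by positivity
  have hq1 : (q : ℝ) - 1 ≠ 0 := by
    have : (2 : ℝ) ≤ q := by exact_mod_cast hq
    linarith
  rw [aux_exch hq t f u v hu hv, aux_det_cd (by omega) _ _ (by positivity)]
  congr 1
  field_simp
  ring

/-- weights `a`, `b`, `c` on the levels `m`, `m+1`, `2m` -/
noncomputable def desF (m : ℕ) (a b c : ℝ) (k : ℕ) : ℝ :=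
  (if k = m then a / (Nat.choose (2*m) m : ℝ) else 0) +
  (if k = m + 1 then b / (Nat.choose (2*m) (m+1) : ℝ) else 0) + (if k = 2 * m then c else 0)

lemma aux_level {q : ℕ} (k : ℕ) (hk : k ≤ q) (w : ℝ) (h : ℕ → ℝ) :
    ∑ S : Finset (Fin q), (if S.card = k then w else 0) * h S.card
      = (Nat.choose q k : ℝ) * (w * h k) := by
  have := Finset.sum_powerset_apply_card (fun j => (if j = k then w else 0) * h j)
    (x := (Finset.univ : Finset (Fin q)))
  rw [Finset.powerset_univ] at this
  rw [this]
  simp [Finset.card_univ, Finset.sum_ite_eq']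
  omega

lemma aux_moment (m : ℕ) (hm : 2 ≤ m) (a b c : ℝ) (h : ℕ → ℝ) :
    ∑ S : Finset (Fin (2*m)), desF m a b c S.card * h S.card
      = a * h m + b * h (m+1) + c * h (2*m) := by
  have h1 : (Nat.choose (2*m) m : ℝ) ≠ 0 := by
    exact_mod_cast (Nat.choose_pos (by omega)).ne'
  have h2 : (Nat.choose (2*m) (m+1) : ℝ) ≠ 0 := by
    exact_mod_cast (Nat.choose_pos (by omega)).ne'
  simp only [desF, add_mul, Finset.sum_add_distrib]
  rw [aux_level m (by omega), aux_level (m+1) (by omega), aux_level (2*m) le_rfl]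
  simp
  field_simp

lemma aux_star (m : ℕ) (hm : 2 ≤ m) :
    (fun S : Finset (Fin (2*m)) =>
          if S.card = m ∨ S.card = m + 1 then
            ((Nat.choose (2*m) m : ℝ) + (Nat.choose (2*m) (m+1) : ℝ))⁻¹ else 0) =
    fun S => desF m ((m+1)/(2*m+1)) (m/(2*m+1)) 0 S.card := by
  have h1 : (Nat.choose (2*m) m : ℝ) ≠ 0 := by
    exact_mod_cast (Nat.choose_pos (by omega)).ne'
  have h2 : (Nat.choose (2*m) (m+1) : ℝ) ≠ 0 := by
    exact_mod_cast (Nat.choose_pos (by omega)).ne'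
  have h3 : (Nat.choose (2*m) (m+1) : ℝ) * (m+1) = Nat.choose (2*m) m * m := by
    have := Nat.choose_succ_right_eq (2*m) m
    rw [show 2*m - m = m by omega] at this
    exact_mod_cast this
  have hm0 : (m : ℝ) ≠ 0 := by positivity
  have hs : (Nat.choose (2*m) m : ℝ) + (Nat.choose (2*m) (m+1) : ℝ) ≠ 0 := by positivity
  funext S
  by_cases e1 : S.card = m
  · have : ¬ m = 2 * m := by omega
    simp [desF, e1]
    field_simp
    linarith
  · by_cases e2 : S.card = m + 1
    · have : ¬ m + 1 = 2 * m := by omega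
      simp [desF, e2]
      field_simp
      linarith
    · simp [desF, e1, e2]

lemma aux_star_u (m : ℕ) (hm : 2 ≤ m) :
    ∑ S : Finset (Fin (2*m)), desF m ((m+1)/(2*m+1)) (m/(2*m+1)) 0 S.card * (S.card : ℝ)
      = 2*m*(m+1)/(2*m+1) := by
  rw [aux_moment m hm _ _ _ (fun k => (k : ℝ))]
  push_cast
  field_simp
  ring

lemma aux_star_v (m : ℕ) (hm : 2 ≤ m) :
    ∑ S : Finset (Fin (2*m)), desF m ((m+1)/(2*m+1)) (m/(2*m+1)) 0 S.card * (S.card : ℝ) ^ 2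
      = m*(m+1) := by
  rw [aux_moment m hm _ _ _ (fun k => (k : ℝ) ^ 2)]
  push_cast
  field_simp
  ring

lemma aux_star_det (m : ℕ) (hm : 2 ≤ m) (t : ℝ) :
    (HmatB t (fun S : Finset (Fin (2*m)) =>
      desF m ((m+1)/(2*m+1)) (m/(2*m+1)) 0 S.card)).det =
    (((m : ℝ)+1)/(2*(2*m+1))) ^ (2*m-1) * ((m*(m+1) - t * (2*m*(m+1)/(2*m+1))^2) / (2*m)) := by
  have hx : (2 : ℝ) ≤ m := by exact_mod_cast hm
  have h1 : (2 * (m:ℝ) - 1) ≠ 0 := by linarith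
  have hm2 : ((m:ℝ) * 2 - 1) ≠ 0 := by linarith
  have key : (((2*m : ℕ) : ℝ) * (2*m*(m+1)/(2*m+1)) - m*(m+1)) =
      m*(m+1)*(2*m-1)/(2*m+1) := by
    push_cast; field_simp; ring
  rw [aux_det_exch (by omega) t _ _ _ (aux_star_u m hm) (aux_star_v m hm)
    (by rw [key]; positivity), key]
  congr 1
  · congr 1
    push_cast
    field_simp
  · push_cast; ring

lemma aux_L_pos (x t : ℝ) (hx : 2 ≤ x) (ht1 : t < 1) :
    0 < x*(x+1) - t * (2*x*(x+1)/(2*x+1))^2 := by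
  have : x*(x+1) - t * (2*x*(x+1)/(2*x+1))^2 =
      x*(x+1) * (1 + 4*x*(x+1)*(1-t)) / (2*x+1)^2 := by
    field_simp; ring
  rw [this]
  have : 0 < 1 - t := by linarith
  positivity

lemma aux_scalar (x t u v s : ℝ) (hx : 2 ≤ x) (ht0 : 0 ≤ t) (ht1 : t < 1)
    (ht : t ≤ (2*x+1)/(2*x+2)) (hs : u^2 ≤ 2*x*s) (hv : (2*x+1)*u - x*(x+1) ≤ v) :
    2*(2*x+1)/(x+1) * (u - t*s) +
      (-(2*(2*x+1)*((2*x+1) - 2*t*(x+1))/((x+1)*(1 + 4*x*(x+1)*(1-t))))) * (v - t*u^2) ≤ 2*x := by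
  have h1t : 0 < 1 - t := by linarith
  have hE : 0 ≤ (2*x+1) - 2*t*(x+1) := by
    rw [le_div_iff₀ (by linarith)] at ht; linarith
  have hL : 0 < 1 + 4*x*(x+1)*(1-t) := by positivity
  set L := 1 + 4*x*(x+1)*(1-t) with hLdef
  set e := 2*(2*x+1)*((2*x+1) - 2*t*(x+1))/((x+1)*L) with he
  have he0 : 0 ≤ e := by positivity
  have hr : 0 ≤ 2*(2*x+1)/(x+1) * t := by positivity
  have i1 : u^2/(2*x) ≤ s := by rw [div_le_iff₀ (by linarith)]; linarith
  have i2 := mul_le_mul_of_nonneg_left i1 hr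
  have i3 := mul_le_mul_of_nonneg_left hv he0
  have key : 2*(2*x+1)/(x+1) * u - 2*(2*x+1)/(x+1) * t * (u^2/(2*x))
      - e * ((2*x+1)*u - x*(x+1)) + e*t*u^2 =
      2*x - t * (2*x+1)^2 / (x * (x+1) * L) * (u - 2*x*(x+1)/(2*x+1))^2 := by
    rw [he]
    field_simp
    rw [hLdef]
    ring
  have : 0 ≤ t * (2*x+1)^2 / (x * (x+1) * L) * (u - 2*x*(x+1)/(2*x+1))^2 := by positivity
  linarith

lemma aux_forward (m : ℕ) (hm : 2 ≤ m) (t : ℝ) (ht0 : 0 ≤ t) (ht1 : t < 1)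
    (ht : t ≤ (2*(m:ℝ)+1)/(2*m+2)) (p : Finset (Fin (2*m)) → ℝ) (hp : designMeasureB p) :
    (HmatB t p).det ≤ (HmatB t (fun S : Finset (Fin (2*m)) =>
      desF m ((m+1)/(2*m+1)) (m/(2*m+1)) 0 S.card)).det := by
  have hx : (2 : ℝ) ≤ m := by exact_mod_cast hm
  have h1t : 0 < 1 - t := by linarith
  have hm1 : (2 * (m:ℝ) - 1) ≠ 0 := by linarith
  have hm2 : ((m:ℝ) * 2 - 1) ≠ 0 := by linarith
  set K := HmatB t (fun S : Finset (Fin (2*m)) =>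
      desF m ((m+1)/(2*m+1)) (m/(2*m+1)) 0 S.card) with hK
  have hKpos : 0 < K.det := by
    rw [hK, aux_star_det m hm]
    have := aux_L_pos m t hx ht1
    positivity
  have hKe : K = cdMat (2*m) (((m:ℝ)+1)/(2*(2*m+1)))
      (((m:ℝ)+1)*((2*m+1) - 2*t*(m+1))/(2*(2*m+1)^2)) := by
    rw [hK, aux_exch (by omega) t _ _ _ (aux_star_u m hm) (aux_star_v m hm)]
    push_cast
    congr 1 <;> field_simp <;> ring
  have hE : 0 ≤ (2*(m:ℝ)+1) - 2*t*(m+1) := by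
    rw [le_div_iff₀ (by linarith)] at ht; linarith
  have hKpsd : K.PosSemidef := by
    rw [hKe]
    exact aux_cd_psd _ _ (by positivity) (by positivity)
  have hL : 0 < 1 + 4*(m:ℝ)*(m+1)*(1-t) := by positivity
  set M := cdMat (2*m) (2*(2*(m:ℝ)+1)/(m+1))
    (-(2*(2*(m:ℝ)+1)*((2*m+1) - 2*t*(m+1))/((m+1)*(1 + 4*(m:ℝ)*(m+1)*(1-t))))) with hM
  have hKM : K * M = 1 := by
    rw [hKe, hM, aux_cd_mul, ← aux_cd_one]
    push_cast
    congr 1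
    · field_simp
    · field_simp
      ring
  have hMpsd : M.PosSemidef := by
    rw [← Matrix.inv_eq_right_inv hKM]
    exact hKpsd.inv
  have htr : (M * HmatB t p).trace ≤ ((2*m : ℕ) : ℝ) := by
    rw [hM, aux_trace_cd_mul]
    simp_rw [aux_H_apply]
    simp only [Finset.sum_sub_distrib, ← Finset.mul_sum, ← Finset.sum_mul]
    rw [aux_trace_G, aux_sum_G, aux_sum_g, ← sq]
    push_cast
    apply aux_scalar _ _ _ _ _ hx ht0 ht1 ht
    · have := sq_sum_le_card_mul_sum_sq (s := Finset.univ) (f := gvecB p)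
      rw [aux_sum_g] at this
      simp only [sq, Finset.card_univ, Fintype.card_fin] at this ⊢
      push_cast at this
      exact this
    · obtain ⟨-, h0, h1⟩ := hp
      have : (2*(m:ℝ)+1) * ∑ S, p S * (S.card : ℝ) - m*(m+1) =
          ∑ S, p S * ((2*m+1) * (S.card : ℝ) - m*(m+1)) := by
        simp_rw [mul_sub, Finset.sum_sub_distrib, ← Finset.sum_mul, h1, Finset.mul_sum]
        rw [one_mul]
        congr 1
        exact Finset.sum_congr rfl fun S _ => by ring
      rw [this]
      refine Finset.sum_le_sum fun S _ => mul_le_mul_of_nonneg_left ?_ (h0 S)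
      rcases Nat.lt_or_ge m S.card with h | h
      · have h' : (m:ℝ) + 1 ≤ S.card := by exact_mod_cast h
        nlinarith
      · have h' : (S.card : ℝ) ≤ m := by exact_mod_cast h
        nlinarith
  have h2 := aux_det_mul_le M (HmatB t p) hMpsd (aux_H_psd t ht1.le p hp) htr
  have h3 : K.det * M.det = 1 := by rw [← Matrix.det_mul, hKM, Matrix.det_one]
  calc (HmatB t p).det = K.det * (M.det * (HmatB t p).det) := by
        rw [← mul_assoc, h3, one_mul]
    _ ≤ K.det * 1 := mul_le_mul_of_nonneg_left h2 hKpos.le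
    _ = K.det := mul_one _

lemma aux_backward (m : ℕ) (hm : 2 ≤ m) (t : ℝ) (ht1 : t < 1)
    (ht : (2*(m:ℝ)+1)/(2*m+2) < t) : ∃ p : Finset (Fin (2*m)) → ℝ, designMeasureB p ∧
    (HmatB t (fun S : Finset (Fin (2*m)) =>
      desF m ((m+1)/(2*m+1)) (m/(2*m+1)) 0 S.card)).det < (HmatB t p).det := by
  have hx : (2 : ℝ) ≤ m := by exact_mod_cast hm
  have hm1 : (2 * (m:ℝ) - 1) ≠ 0 := by linarith
  have hm2 : ((m:ℝ) * 2 - 1) ≠ 0 := by linarith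
  obtain ⟨ε, hε⟩ : ∃ ε : ℝ, ε = (2*t*(m+1) - (2*m+1))/(2*m+1) := ⟨_, rfl⟩
  have ht' : 2*m+1 < 2*t*(m+1) := by
    rw [div_lt_iff₀ (by linarith)] at ht; linarith
  have hε0 : 0 < ε := by
    rw [hε]; apply div_pos <;> linarith
  have hε1 : ε ≤ 1 := by
    rw [hε, div_le_one (by linarith)]; nlinarith
  have htε : t = (1+ε)*(2*m+1)/(2*(m+1)) := by rw [hε]; field_simp; ring
  obtain ⟨w, hw⟩ : ∃ w : ℝ, w = 1 - 1/(m*(2*m+1)) := ⟨_, rfl⟩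
  have hw1 : 0 ≤ 1 - w := by rw [hw]; ring_nf; positivity
  have hw0 : 0 ≤ w := by
    rw [hw, sub_nonneg, div_le_one (by positivity)]; nlinarith
  obtain ⟨a, ha⟩ : ∃ a : ℝ, a = (1-ε)*((m+1)/(2*m+1)) + ε*w := ⟨_, rfl⟩
  obtain ⟨b, hb⟩ : ∃ b : ℝ, b = (1-ε)*(m/(2*m+1)) := ⟨_, rfl⟩
  obtain ⟨c, hc⟩ : ∃ c : ℝ, c = ε*(1-w) := ⟨_, rfl⟩
  have hε2 : 0 ≤ 1 - ε := by linarith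
  have ha0 : 0 ≤ a := by rw [ha]; positivity
  have hb0 : 0 ≤ b := by rw [hb]; positivity
  have hc0 : 0 ≤ c := by rw [hc]; positivity
  obtain ⟨δ, hδ⟩ : ∃ δ : ℝ, δ = ε*(m-1)/(2*m+1) := ⟨_, rfl⟩
  have hu : ∑ S : Finset (Fin (2*m)), desF m a b c S.card * (S.card : ℝ)
      = 2*m*(m+1)/(2*m+1) - δ := by
    rw [aux_moment m hm _ _ _ (fun k => (k : ℝ)), ha, hb, hc, hw, hδ]
    push_cast
    field_simp
    ring
  have hv : ∑ S : Finset (Fin (2*m)), desF m a b c S.card * (S.card : ℝ) ^ 2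
      = m*(m+1) - 2*m*δ := by
    rw [aux_moment m hm _ _ _ (fun k => (k : ℝ) ^ 2), ha, hb, hc, hw, hδ]
    push_cast
    field_simp
    ring
  have key : (((2*m : ℕ) : ℝ) * (2*m*(m+1)/(2*m+1) - δ) - (m*(m+1) - 2*m*δ)) =
      m*(m+1)*(2*m-1)/(2*m+1) := by
    push_cast; field_simp; ring
  refine ⟨fun S => desF m a b c S.card, ⟨?_, ?_, ?_⟩, ?_⟩
  · have h1 : ¬ (0 = m) := by omega
    simp [desF, h1]
    omega
  · intro S
    simp only [desF]
    have : ∀ (P : Prop) [Decidable P] (y : ℝ), 0 ≤ y → 0 ≤ (if P then y else 0) := by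
      intro P _ y hy
      split_ifs
      · exact hy
      · exact le_rfl
    exact add_nonneg (add_nonneg (this _ _ (by positivity)) (this _ _ (by positivity)))
      (this _ _ hc0)
  · have := aux_moment m hm a b c (fun _ => 1)
    simp only [mul_one] at this
    rw [this, ha, hb, hc]
    field_simp
    ring
  · rw [aux_star_det m hm, aux_det_exch (by omega) t _ _ _ hu hv (by rw [key]; positivity), key]
    have e1 : (m:ℝ)*(m+1)*(2*m-1)/(2*m+1) / (((2*m : ℕ) : ℝ) * (((2*m : ℕ) : ℝ) - 1)) =
        ((m : ℝ)+1)/(2*(2*m+1)) := by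
      push_cast; field_simp
    rw [e1]
    apply mul_lt_mul_of_pos_left _ (by positivity)
    push_cast
    apply div_lt_div_of_pos_right _ (by positivity)
    have hδ0 : 0 < δ := by
      rw [hδ]
      have : (0:ℝ) < m - 1 := by linarith
      positivity
    have hδε : δ ≤ ε := by
      rw [hδ, div_le_iff₀ (by positivity)]; nlinarith
    have hid : m*(m+1) - 2*m*δ - t*(2*m*(m+1)/(2*m+1) - δ)^2 -
        (m*(m+1) - t * (2*m*(m+1)/(2*m+1))^2) = δ * (2*m*ε - t*δ) := by
      rw [htε]; field_simp; ring
    have : 0 < 2*m*ε - t*δ := by nlinarith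
    have := mul_pos hδ0 this
    linarith

theorem statement_12 (m : ℕ) (hm : 2 ≤ m) (t : ℝ) (ht0 : 0 ≤ t) (ht1 : t < 1) :
    (IsUnit (HmatB t (fun S : Finset (Fin (2*m)) =>
          if S.card = m ∨ S.card = m + 1 then
            ((Nat.choose (2*m) m : ℝ) + (Nat.choose (2*m) (m+1) : ℝ))⁻¹ else 0)).det
      ∧ ∀ p : Finset (Fin (2*m)) → ℝ, designMeasureB p → IsUnit (HmatB t p).det →
          (HmatB t p).det ≤ (HmatB t (fun S : Finset (Fin (2*m)) =>
            if S.card = m ∨ S.card = m + 1 then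
              ((Nat.choose (2*m) m : ℝ) + (Nat.choose (2*m) (m+1) : ℝ))⁻¹ else 0)).det)
    ↔ (0 ≤ t ∧ t ≤ ((2*m : ℝ) + 1) / ((2*m : ℝ) + 2)) := by
  have hx : (2 : ℝ) ≤ m := by exact_mod_cast hm
  rw [aux_star m hm]
  constructor
  · rintro ⟨-, h⟩
    refine ⟨ht0, ?_⟩
    by_contra hcon
    push Not at hcon
    obtain ⟨p, hp, hlt⟩ := aux_backward m hm t ht1 hcon
    have hpos : 0 ≤ (HmatB t (fun S : Finset (Fin (2*m)) =>
        desF m ((m+1)/(2*m+1)) (m/(2*m+1)) 0 S.card)).det := by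
      rw [aux_star_det m hm]
      have := aux_L_pos m t hx ht1
      positivity
    exact absurd (h p hp (isUnit_iff_ne_zero.mpr (by linarith))) (not_le.mpr hlt)
  · rintro ⟨-, ht⟩
    refine ⟨?_, fun p hp _ => aux_forward m hm t ht0 ht1 ht p hp⟩
    rw [aux_star_det m hm, isUnit_iff_ne_zero]
    have := aux_L_pos m t hx ht1
    positivity
end
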